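/- Let (L; γ, H, ν, δ, ε) be an auxiliary structure, let p, q ∈ H with p ∥_ν q, and assume that (δ(p), ε(p), δ(q), ε(q)) is a spanning N6-quadruple of L. Then there exists an auxiliary structure (L'; γ', H', ν', δ', ε') such that: (L; γ, H, ν, δ, ε) is a substructure of (L'; γ', H', ν', δ', ε'); H' = H; ν' is the smallest reflexive and transitive relation on H containing ν ∪ {(p, q)}; δ' = δ and ε' = ε; and if (L; γ, H, ν, δ, ε) is countable then so is (L'; γ', H', ν', δ', ε'). -/

import Mathlib

/-- A lattice congruence: an equivalence relation compatible with meet and join. -/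
def IsLatCon {L : Type*} [Lattice L] (r : L → L → Prop) : Prop :=
  Equivalence r ∧
  (∀ a b c d, r a b → r c d → r (a ⊓ c) (b ⊓ d)) ∧
  (∀ a b c d, r a b → r c d → r (a ⊔ c) (b ⊔ d))

/-- The principal congruence generated by the pair `(a, b)`:
the smallest congruence relating `a` and `b`. -/
def cg {L : Type*} [Lattice L] (a b : L) (x y : L) : Prop :=
  ∀ r : L → L → Prop, IsLatCon r → r a b → r x y

/-- The ordered set of principal congruences of `L`, ordered by inclusion. -/
def Princ (L : Type*) [Lattice L] : Type _ :=
  {θ : L → L → Prop // ∃ a b : L, θ = cg a b}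

instance (L : Type*) [Lattice L] : PartialOrder (Princ L) :=
  inferInstanceAs (PartialOrder {θ : L → L → Prop // ∃ a b : L, θ = cg a b})
/-- `(L; γ, H, ν)` is a quasi-colored lattice: `ν` is reflexive and transitive, `γ` is
surjective onto `H` via ordered pairs, and conditions (C1), (C2) hold for all ordered
pairs. (Here `γ` is given as a total map whose values only matter on ordered pairs.) -/
def IsQuasiColored {L H : Type*} [Lattice L] (γ : L → L → H) (ν : H → H → Prop) : Prop :=
  Reflexive ν ∧ Transitive ν ∧
  (∀ h : H, ∃ x y : L, x ≤ y ∧ γ x y = h) ∧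
  (∀ u₁ v₁ u₂ v₂ : L, u₁ ≤ v₁ → u₂ ≤ v₂ → ν (γ u₁ v₁) (γ u₂ v₂) →
    ∀ x y : L, cg u₁ v₁ x y → cg u₂ v₂ x y) ∧
  (∀ u₁ v₁ u₂ v₂ : L, u₁ ≤ v₁ → u₂ ≤ v₂ →
    (∀ x y : L, cg u₁ v₁ x y → cg u₂ v₂ x y) → ν (γ u₁ v₁) (γ u₂ v₂))

/-- The congruence generated by a set of pairs, as the least congruence containing it. -/
def cgSet {L : Type*} [Lattice L] (S : Set (L × L)) (x y : L) : Prop :=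
  ∀ r : L → L → Prop, IsLatCon r → (∀ w ∈ S, r w.1 w.2) → r x y

/-- The least reflexive transitive relation (quasiorder) containing `R`. -/
def quoClosure {H : Type*} (R : H → H → Prop) (x y : H) : Prop :=
  ∀ μ : H → H → Prop, Reflexive μ → Transitive μ → (∀ a b : H, R a b → μ a b) → μ x y

/-- `(a₁, b₁, a₂, b₂)` is an N₆-quadruple of `L`. -/
def IsN6 {L : Type*} [Lattice L] (a₁ b₁ a₂ b₂ : L) : Prop :=
  a₁ < b₁ ∧ a₂ < b₂ ∧ a₁ ⊓ a₂ = b₁ ⊓ b₂ ∧ a₁ ⊔ a₂ = b₁ ⊔ b₂ ∧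
  ({a₁ ⊓ a₂, a₁, b₁, a₂, b₂, a₁ ⊔ a₂} : Set L).ncard = 6 ∧
  SupClosed ({a₁ ⊓ a₂, a₁, b₁, a₂, b₂, a₁ ⊔ a₂} : Set L) ∧
  InfClosed ({a₁ ⊓ a₂, a₁, b₁, a₂, b₂, a₁ ⊔ a₂} : Set L)

/-- A spanning N₆-quadruple: an N₆-quadruple with `b₁ ⊓ b₂ = 0_L` and `a₁ ⊔ a₂ = 1_L`. -/
def IsSpanningN6 {L : Type*} [Lattice L] (a₁ b₁ a₂ b₂ : L) : Prop :=
  IsN6 a₁ b₁ a₂ b₂ ∧ IsBot (b₁ ⊓ b₂) ∧ IsTop (a₁ ⊔ a₂)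

/-- A strong N₆-quadruple: a spanning one satisfying the extra join/meet conditions. -/
def IsStrongN6 {L : Type*} [Lattice L] (a₁ b₁ a₂ b₂ : L) : Prop :=
  IsSpanningN6 a₁ b₁ a₂ b₂ ∧
  (∀ x : L, b₁ ⊓ b₂ < x → x ≤ b₁ → x ⊔ a₂ = a₁ ⊔ a₂) ∧
  (∀ x : L, b₁ ⊓ b₂ < x → x ≤ b₂ → x ⊔ a₁ = a₁ ⊔ a₂) ∧
  (∀ x : L, a₁ ≤ x → x < a₁ ⊔ a₂ → x ⊓ b₂ = b₁ ⊓ b₂) ∧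
  (∀ x : L, a₂ ≤ x → x < a₁ ⊔ a₂ → x ⊓ b₁ = b₁ ⊓ b₂)

/-- An auxiliary structure `(L; γ, H, ν, δ, ε)`, conditions (A1)–(A8). -/
structure AuxStr (L : Type*) (H : Type*) [Lattice L] where
  γ : L → L → H
  ν : H → H → Prop
  δ : H → L
  ε : H → L
  /-- `0_H`, the least element of `(H; ν)`. -/
  zero : H
  /-- (A1): `(L; γ, H, ν)` is a quasi-colored lattice. -/
  quasi : IsQuasiColored γ ν
  /-- (A2): `0_H` is a least element … -/
  zero_least : ∀ x : H, ν zero x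
  /-- (A2): … and it is the only least element … -/
  least_unique : ∀ z : H, (∀ x : H, ν z x) → z = zero
  /-- (A2): … and `(H; ν)` has at most one greatest element. -/
  greatest_unique : ∀ g₁ g₂ : H, (∀ x : H, ν x g₁) → (∀ x : H, ν x g₂) → g₁ = g₂
  /-- (A3): `δ 0_H = ε 0_H` … -/
  delta_zero : δ zero = ε zero
  /-- (A3): … and `δ x ≺ ε x` for `x ≠ 0_H`. -/
  delta_covby : ∀ x : H, x ≠ zero → δ x ⋖ ε x
  /-- (A4): `γ (δ p) (ε p) = p`. -/
  gamma_delta : ∀ p : H, γ (δ p) (ε p) = p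
  /-- (A5): distinct nonzero colors give N₆-quadruples. -/
  n6 : ∀ p q : H, p ≠ zero → q ≠ zero → p ≠ q → IsN6 (δ p) (ε p) (δ q) (ε q)
  /-- (A6): for `ν`-incomparable `p, q`, spanning N₆-quadruples are strong. -/
  strong : ∀ p q : H, ¬ ν p q → ¬ ν q p →
    IsSpanningN6 (δ p) (ε p) (δ q) (ε q) → IsStrongN6 (δ p) (ε p) (δ q) (ε q)
  /-- (A7): if `L` is bounded with `|L| > 1`, there are at least three doubly-covering
  complements of everything else. -/
  atoms3 : ∀ bot top : L, IsBot bot → IsTop top → bot ≠ top →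
    ∃ x₁ x₂ x₃ : L, x₁ ≠ x₂ ∧ x₁ ≠ x₃ ∧ x₂ ≠ x₃ ∧
      ∀ x ∈ ({x₁, x₂, x₃} : Set L), bot ⋖ x ∧ x ⋖ top ∧
        ∀ y : L, y ≠ bot → y ≠ top → y ≠ x → x ⊓ y = bot ∧ x ⊔ y = top
  /-- (A8): if `H` has a greatest element `1_H` and `|L| > 1`, the congruence generated
  by the pairs `(δ p, ε p)`, `p ≠ 1_H`, is not the full congruence. -/
  notfull : ∀ one : H, (∀ x : H, ν x one) → (∃ a b : L, a ≠ b) →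
    ∃ x y : L, ¬ cgSet {w : L × L | ∃ p : H, p ≠ one ∧ w = (δ p, ε p)} x y

/-- A substructure embedding of auxiliary structures: `f` embeds `L₁` as a sublattice
of `L₂`, `g` embeds `H₁` into `H₂` with `ν₁ ⊆ ν₂` and `0` preserved, and `γ`, `δ`, `ε`
of the small structure are the restrictions of those of the big one. -/
structure AuxSub {L₁ H₁ L₂ H₂ : Type*} [Lattice L₁] [Lattice L₂]
    (A : AuxStr L₁ H₁) (B : AuxStr L₂ H₂) where
  f : L₁ → L₂
  g : H₁ → H₂
  f_inj : Function.Injective f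
  g_inj : Function.Injective g
  f_inf : ∀ x y : L₁, f (x ⊓ y) = f x ⊓ f y
  f_sup : ∀ x y : L₁, f (x ⊔ y) = f x ⊔ f y
  g_zero : g A.zero = B.zero
  nu_mono : ∀ x y : H₁, A.ν x y → B.ν (g x) (g y)
  gamma_comm : ∀ x y : L₁, x ≤ y → B.γ (f x) (f y) = g (A.γ x y)
  delta_comm : ∀ p : H₁, f (A.δ p) = B.δ (g p)
  eps_comm : ∀ p : H₁, f (A.ε p) = B.ε (g p)
universe u v

/-- Two prime intervals `[a, b]`, `[c, d]` of a bounded lattice with a congruence `Ψ` that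
isolates the bounds, such that `[a, b]` and `[c, d]` lie in two complementary `Ψ`-classes. -/
structure Gadget (L : Type*) [Lattice L] where
  bot : L
  top : L
  a : L
  b : L
  c : L
  d : L
  Ψ : L → L → Prop
  con : IsLatCon Ψ
  bot_le : ∀ z, bot ≤ z
  le_top : ∀ z, z ≤ top
  covby_ab : a ⋖ b
  covby_cd : c ⋖ d
  rel_ab : Ψ a b
  rel_cd : Ψ c d
  bot_isolated : ∀ z, Ψ bot z → z = bot
  top_isolated : ∀ z, Ψ top z → z = top
  inf_ac : a ⊓ c = bot
  sup_ac : a ⊔ c = top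
  strong : ∀ z, z ≠ bot → z ≤ c → z ⊔ a = top

namespace Gadget

variable {L : Type*} [Lattice L] (G : Gadget L)

lemma eq_top_of_le {G : Gadget L} {z : L} (h : G.top ≤ z) : z = G.top := le_antisymm (G.le_top z) h

lemma a_le_b : G.a ≤ G.b := G.covby_ab.le

lemma c_le_d : G.c ≤ G.d := G.covby_cd.le

lemma ne_bot_a {y : L} (h : G.Ψ G.a y) : y ≠ G.bot := by
  rintro rfl
  have ha := G.bot_isolated _ (G.con.1.symm h)
  have hb := G.bot_isolated _ (ha ▸ G.rel_ab)
  exact G.covby_ab.lt.ne (ha.trans hb.symm)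

lemma ne_bot_c {y : L} (h : G.Ψ G.c y) : y ≠ G.bot := by
  rintro rfl
  have ha := G.bot_isolated _ (G.con.1.symm h)
  have hb := G.bot_isolated _ (ha ▸ G.rel_cd)
  exact G.covby_cd.lt.ne (ha.trans hb.symm)

lemma ne_top_a {y : L} (h : G.Ψ G.a y) : y ≠ G.top := by
  rintro rfl
  have ha := G.top_isolated _ (G.con.1.symm h)
  have hb := G.top_isolated _ (ha ▸ G.rel_ab)
  exact G.covby_ab.lt.ne (ha.trans hb.symm)

lemma ne_top_c {y : L} (h : G.Ψ G.c y) : y ≠ G.top := by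
  rintro rfl
  have ha := G.top_isolated _ (G.con.1.symm h)
  have hb := G.top_isolated _ (ha ▸ G.rel_cd)
  exact G.covby_cd.lt.ne (ha.trans hb.symm)

lemma rel_sup {k y y' : L} (h : G.Ψ k y) (h' : G.Ψ k y') : G.Ψ k (y ⊔ y') := by
  simpa using G.con.2.2 _ _ _ _ h h'

lemma rel_inf {k y y' : L} (h : G.Ψ k y) (h' : G.Ψ k y') : G.Ψ k (y ⊓ y') := by
  simpa using G.con.2.1 _ _ _ _ h h'

lemma rel_convex {k y y' : L} (h : k ≤ y) (h' : y ≤ y') (hk : G.Ψ k y') : G.Ψ k y := by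
  have := G.con.2.1 _ _ _ _ hk (G.con.1.refl y)
  rwa [inf_eq_left.2 h, inf_eq_right.2 h'] at this

lemma inf_eq_bot {y t : L} (hy : G.Ψ G.a y) (ht : G.Ψ G.c t) : y ⊓ t = G.bot := by
  have := G.con.2.1 _ _ _ _ hy ht
  rw [G.inf_ac] at this
  exact G.bot_isolated _ this

/-- Nothing but the bottom lies below members of both classes. -/
lemma eq_bot {z y t : L} (hy : G.Ψ G.a y) (ht : G.Ψ G.c t) (h : z ≤ y) (h' : z ≤ t) :
    z = G.bot :=
  le_antisymm ((le_inf h h').trans (G.inf_eq_bot hy ht).le) (G.bot_le z)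

lemma bot_ne_top : G.bot ≠ G.top := fun h =>
  G.ne_bot_a (G.con.1.refl _) (le_antisymm (h ▸ G.le_top _) (G.bot_le _))

/-- The part of the `Ψ`-class of `a` above `a`. -/
def InA (y : L) : Prop := G.a ≤ y ∧ G.Ψ G.a y

/-- The part of the `Ψ`-class of `c` above `c`. -/
def InC (t : L) : Prop := G.c ≤ t ∧ G.Ψ G.c t

variable {G}

lemma inA_a : G.InA G.a := ⟨le_rfl, G.con.1.refl _⟩

lemma inC_c : G.InC G.c := ⟨le_rfl, G.con.1.refl _⟩

lemma inA_b : G.InA G.b := ⟨G.a_le_b, G.rel_ab⟩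

lemma inC_d : G.InC G.d := ⟨G.c_le_d, G.rel_cd⟩

lemma InA.sup {y y' : L} (h : G.InA y) (h' : G.InA y') : G.InA (y ⊔ y') :=
  ⟨h.1.trans le_sup_left, G.rel_sup h.2 h'.2⟩

lemma InC.sup {y y' : L} (h : G.InC y) (h' : G.InC y') : G.InC (y ⊔ y') :=
  ⟨h.1.trans le_sup_left, G.rel_sup h.2 h'.2⟩

lemma InA.inf {y y' : L} (h : G.InA y) (h' : G.InA y') : G.InA (y ⊓ y') :=
  ⟨le_inf h.1 h'.1, G.rel_inf h.2 h'.2⟩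

lemma InC.inf {y y' : L} (h : G.InC y) (h' : G.InC y') : G.InC (y ⊓ y') :=
  ⟨le_inf h.1 h'.1, G.rel_inf h.2 h'.2⟩

lemma InA.of_le {y y' : L} (h' : G.InA y') (h : G.a ≤ y) (hy : y ≤ y') : G.InA y :=
  ⟨h, G.rel_convex h hy h'.2⟩

lemma InC.of_le {y y' : L} (h' : G.InC y') (h : G.c ≤ y) (hy : y ≤ y') : G.InC y :=
  ⟨h, G.rel_convex h hy h'.2⟩

lemma InA.ne_top {y : L} (h : G.InA y) : y ≠ G.top := G.ne_top_a h.2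

lemma InC.ne_top {y : L} (h : G.InC y) : y ≠ G.top := G.ne_top_c h.2

lemma InA.ne_bot {y : L} (h : G.InA y) : y ≠ G.bot := G.ne_bot_a h.2

lemma InC.ne_bot {y : L} (h : G.InC y) : y ≠ G.bot := G.ne_bot_c h.2

lemma InA.inf_eq_bot {y t : L} (hy : G.InA y) (ht : G.InC t) : y ⊓ t = G.bot :=
  G.inf_eq_bot hy.2 ht.2

lemma InA.eq_bot {z y t : L} (hy : G.InA y) (ht : G.InC t) (h : z ≤ y) (h' : z ≤ t) :
    z = G.bot :=
  G.eq_bot hy.2 ht.2 h h'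

lemma InA.sup_eq_top {y t : L} (hy : G.InA y) (ht : G.InC t) : y ⊔ t = G.top :=
  eq_top_of_le (G.sup_ac ▸ sup_le_sup hy.1 ht.1)

lemma InA.rel {y y' : L} (h : G.InA y) (r : G.Ψ y y') (h' : G.a ≤ y') : G.InA y' :=
  ⟨h', G.con.1.trans h.2 r⟩

lemma InC.rel {y y' : L} (h : G.InC y) (r : G.Ψ y y') (h' : G.c ≤ y') : G.InC y' :=
  ⟨h', G.con.1.trans h.2 r⟩

lemma inC_d_sup_iff {z : L} : G.InC (G.d ⊔ z) ↔ G.InC (G.c ⊔ z) := by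
  have h := G.con.2.2 _ _ _ _ G.rel_cd (G.con.1.refl z)
  exact ⟨fun k => k.of_le le_sup_left (sup_le_sup_right G.c_le_d _),
    fun k => k.rel h (G.c_le_d.trans le_sup_left)⟩

/-- A nonzero element below a member of the class of `c` is joined to the top by `a`. -/
lemma InC.a_sup_eq_top {z t : L} (ht : G.InC t) (hz : z ≠ G.bot) (h : z ≤ t) :
    G.a ⊔ z = G.top := by
  have h₁ := G.con.2.1 _ _ _ _ ht.2 (G.con.1.refl z)
  rw [inf_eq_right.2 h] at h₁
  have h₂ : G.c ⊓ z ≠ G.bot := fun h₀ => hz (G.bot_isolated _ (h₀ ▸ h₁))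
  refine eq_top_of_le ?_
  rw [← G.strong _ h₂ inf_le_left, sup_comm]
  exact sup_le_sup_left inf_le_right _

end Gadget

/-- The extension of `L` by a three-element chain `o < s < w` of new elements below copies
`u y` of the elements of the class of `a` and copies `x t` of the elements of the class of
`c`. -/
inductive HExt {L : Type*} [Lattice L] (G : Gadget L) where
  | old (z : L)
  | o
  | s
  | w
  | u (y : L) (h : G.InA y)
  | x (t : L) (h : G.InC t)

namespace HExt

variable {L : Type*} [Lattice L] {G : Gadget L}

/-- The order of the extension. -/
protected def le : HExt G → HExt G → Prop
  | old z, old z' => z ≤ z'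
  | old z, u y _ => z ≤ y
  | old z, x t _ => z ≤ t
  | old z, _ => z = G.bot
  | _, old z => z = G.top
  | o, _ => True
  | s, o => False
  | s, x t _ => G.d ≤ t
  | s, _ => True
  | w, w => True
  | w, u y _ => G.b ≤ y
  | w, x t _ => G.d ≤ t
  | w, _ => False
  | u y _, u y' _ => y ≤ y'
  | u _ _, _ => False
  | x t _, x t' _ => t ≤ t'
  | x _ _, _ => False

instance : PartialOrder (HExt G) where
  le := HExt.le
  le_refl p := by cases p <;> simp [HExt.le]
  le_trans p q r := by
    have := fun y (h : G.InA y) => h.ne_top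
    have := fun y (h : G.InC y) => h.ne_top
    have : G.bot ≠ G.top := G.bot_ne_top
    have := G.bot_le
    have := G.le_top
    have := fun z => G.eq_top_of_le (z := z)
    have := G.c_le_d
    have hb : ∀ z, z ≤ G.bot → z = G.bot := fun z h => le_antisymm h (G.bot_le z)
    rcases p with _ | _ | _ | _ | ⟨_, h₁⟩ | ⟨_, h₁⟩ <;>
      rcases q with _ | _ | _ | _ | ⟨_, h₂⟩ | ⟨_, h₂⟩ <;>
      rcases r with _ | _ | _ | _ | ⟨_, h₃⟩ | ⟨_, h₃⟩ <;> simp only [HExt.le] <;> grind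
  le_antisymm p q := by
    have hu : ∀ z y, G.InA y → z ≤ y → z ≠ G.top :=
      fun z y h hz hz' => h.ne_top (G.eq_top_of_le (hz' ▸ hz))
    have hx : ∀ z y, G.InC y → z ≤ y → z ≠ G.top :=
      fun z y h hz hz' => h.ne_top (G.eq_top_of_le (hz' ▸ hz))
    have := G.bot_ne_top
    rcases p with _ | _ | _ | _ | ⟨_, h₁⟩ | ⟨_, h₁⟩ <;>
      rcases q with _ | _ | _ | _ | ⟨_, h₂⟩ | ⟨_, h₂⟩ <;> simp only [HExt.le] <;> grind

open Classical in
/-- The copy of `y` over `a`, or the top if there is none. -/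
noncomputable def mkU (G : Gadget L) (y : L) : HExt G :=
  if h : G.InA y then u y h else old G.top

open Classical in
/-- The copy of `t` over `c`, or the top if there is none. -/
noncomputable def mkX (G : Gadget L) (t : L) : HExt G :=
  if h : G.InC t then x t h else old G.top

open Classical in
/-- The join of an old element with a new one. -/
noncomputable def oldSup (z : L) : HExt G → HExt G
  | old z' => old (z ⊔ z')
  | o => if z = G.bot then o else if G.InC (G.c ⊔ z) then mkX G (G.c ⊔ z) else mkU G (G.a ⊔ z)
  | s => if z = G.bot then s else if G.InC (G.d ⊔ z) then mkX G (G.d ⊔ z) else mkU G (G.a ⊔ z)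
  | w => if z = G.bot then w else if G.InC (G.d ⊔ z) then mkX G (G.d ⊔ z) else mkU G (G.b ⊔ z)
  | u y _ => mkU G (y ⊔ z)
  | x t _ => mkX G (t ⊔ z)

open Classical in
/-- The meet of an old element with a new one. -/
noncomputable def oldInf (z : L) : HExt G → HExt G
  | old z' => old (z ⊓ z')
  | u y h => if z = G.top then u y h else old (y ⊓ z)
  | x t h => if z = G.top then x t h else old (t ⊓ z)
  | n => if z = G.top then n else old G.bot

/-- The join of the extension. -/
protected noncomputable def sup : HExt G → HExt G → HExt G
  | old z, n => oldSup z n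
  | n, old z => oldSup z n
  | o, n => n
  | n, o => n
  | s, s => s
  | s, w => w
  | s, u y h => u y h
  | s, x t _ => mkX G (t ⊔ G.d)
  | w, s => w
  | w, w => w
  | w, u y _ => mkU G (y ⊔ G.b)
  | w, x t _ => mkX G (t ⊔ G.d)
  | u y h, s => u y h
  | u y _, w => mkU G (y ⊔ G.b)
  | u y _, u y' _ => mkU G (y ⊔ y')
  | u _ _, x _ _ => old G.top
  | x t _, s => mkX G (t ⊔ G.d)
  | x t _, w => mkX G (t ⊔ G.d)
  | x _ _, u _ _ => old G.top
  | x t _, x t' _ => mkX G (t ⊔ t')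

open Classical in
/-- The meet of the extension. -/
protected noncomputable def inf : HExt G → HExt G → HExt G
  | old z, n => oldInf z n
  | n, old z => oldInf z n
  | o, _ => o
  | _, o => o
  | s, s => s
  | s, w => s
  | s, u _ _ => s
  | s, x t _ => if G.d ≤ t then s else o
  | w, s => s
  | w, w => w
  | w, u y _ => if G.b ≤ y then w else s
  | w, x t _ => if G.d ≤ t then w else o
  | u _ _, s => s
  | u y _, w => if G.b ≤ y then w else s
  | u y h, u y' h' => u (y ⊓ y') (h.inf h')
  | u y _, x t _ => if G.d ≤ t then if G.b ≤ y then w else s else o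
  | x t _, s => if G.d ≤ t then s else o
  | x t _, w => if G.d ≤ t then w else o
  | x t _, u y _ => if G.d ≤ t then if G.b ≤ y then w else s else o
  | x t h, x t' h' => x (t ⊓ t') (h.inf h')

lemma le_def (p q : HExt G) : p ≤ q ↔ HExt.le p q := Iff.rfl

protected lemma sup_comm (p q : HExt G) : HExt.sup p q = HExt.sup q p := by
  cases p <;> cases q <;> simp [HExt.sup, oldSup, sup_comm]

protected lemma inf_comm (p q : HExt G) : HExt.inf p q = HExt.inf q p := by
  cases p <;> cases q <;> simp [HExt.inf, oldInf, inf_comm]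

lemma le_mkU {n : HExt G} {y : L} (h : ∀ hy, n ≤ u y hy) (h' : n ≤ old G.top) :
    n ≤ mkU G y := by
  unfold mkU
  split_ifs with hy
  exacts [h hy, h']

lemma le_mkX {n : HExt G} {t : L} (h : ∀ ht, n ≤ x t ht) (h' : n ≤ old G.top) :
    n ≤ mkX G t := by
  unfold mkX
  split_ifs with ht
  exacts [h ht, h']

lemma le_old_top (n : HExt G) : n ≤ old G.top := by
  cases n <;> simp [le_def, HExt.le, G.le_top]

protected lemma le_sup_left (p q : HExt G) : p ≤ HExt.sup p q := by
  have := le_old_top (G := G)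
  have := G.bot_le
  have := G.c_le_d
  have := G.a_le_b
  have hb : ∀ z, z ≤ G.bot → z = G.bot := fun z h => le_antisymm h (G.bot_le z)
  rcases p with _ | _ | _ | _ | ⟨_, h₁⟩ | ⟨_, h₁⟩ <;>
    rcases q with _ | _ | _ | _ | ⟨_, h₂⟩ | ⟨_, h₂⟩ <;>
    simp only [HExt.sup, oldSup] <;> try split_ifs
  all_goals
    first
    | (refine le_mkU (fun _ => ?_) (le_old_top _)
       simp [le_def, HExt.le])
    | (refine le_mkX (fun _ => ?_) (le_old_top _)
       simp [le_def, HExt.le])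
    | simp [le_def, HExt.le, *]

protected lemma sup_le {p q r : HExt G} (hp : p ≤ r) (hq : q ≤ r) : HExt.sup p q ≤ r := by
  have hu : ∀ y, G.InA y → y ≠ G.top := fun y h => h.ne_top
  have hx : ∀ y, G.InC y → y ≠ G.top := fun y h => h.ne_top
  have hA : ∀ y y', G.InA y' → G.a ≤ y → y ≤ y' → G.InA y := fun y y' h => h.of_le
  have hC : ∀ y y', G.InC y' → G.c ≤ y → y ≤ y' → G.InC y := fun y y' h => h.of_le
  have hA' : ∀ y, G.InA y → G.a ≤ y := fun y h => h.1
  have hC' : ∀ y, G.InC y → G.c ≤ y := fun y h => h.1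
  have hexc : ∀ z t, G.InC t → z ≠ G.bot → z ≤ t → G.a ⊔ z = G.top :=
    fun z t h => h.a_sup_eq_top
  have := G.bot_le
  have := G.le_top
  have := G.c_le_d
  have := G.a_le_b
  have := G.bot_ne_top
  have hs : ∀ z y t : L, z ≤ t → y ≤ t → z ⊔ y ≤ t := fun _ _ _ => sup_le
  have hl : ∀ z y : L, z ≤ z ⊔ y := fun _ _ => le_sup_left
  have hr : ∀ z y : L, y ≤ z ⊔ y := fun _ _ => le_sup_right
  have hb : ∀ z, z ≤ G.bot → z = G.bot := fun z h => le_antisymm h (G.bot_le z)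
  rcases p with _ | _ | _ | _ | ⟨_, h₁⟩ | ⟨_, h₁⟩ <;>
    rcases q with _ | _ | _ | _ | ⟨_, h₂⟩ | ⟨_, h₂⟩ <;>
    rcases r with _ | _ | _ | _ | ⟨_, h₃⟩ | ⟨_, h₃⟩ <;>
    simp only [HExt.sup, oldSup, mkU, mkX] <;> (try split_ifs) <;>
    simp only [le_def, HExt.le] at hp hq ⊢ <;> grind

protected lemma inf_le_left (p q : HExt G) : HExt.inf p q ≤ p := by
  have := G.bot_le
  have := G.le_top
  rcases p with _ | _ | _ | _ | ⟨_, h₁⟩ | ⟨_, h₁⟩ <;>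
    rcases q with _ | _ | _ | _ | ⟨_, h₂⟩ | ⟨_, h₂⟩ <;>
    simp only [HExt.inf, oldInf] <;> (try split_ifs) <;> simp [le_def, HExt.le, *]

protected lemma le_inf {p q r : HExt G} (hp : r ≤ p) (hq : r ≤ q) : r ≤ HExt.inf p q := by
  have hu : ∀ y, G.InA y → y ≠ G.top := fun y h => h.ne_top
  have hx : ∀ y, G.InC y → y ≠ G.top := fun y h => h.ne_top
  have hexc : ∀ z y t, G.InA y → G.InC t → z ≤ y → z ≤ t → z = G.bot :=
    fun z y t h => h.eq_bot
  have := G.bot_le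
  have := G.le_top
  have := G.c_le_d
  have := G.a_le_b
  have := G.bot_ne_top
  have hs : ∀ z y t : L, t ≤ z → t ≤ y → t ≤ z ⊓ y := fun _ _ _ => le_inf
  have hb : ∀ z, z ≤ G.bot → z = G.bot := fun z h => le_antisymm h (G.bot_le z)
  have ht : ∀ z, G.top ≤ z → z = G.top := fun z h => le_antisymm (G.le_top z) h
  rcases p with _ | _ | _ | _ | ⟨_, h₁⟩ | ⟨_, h₁⟩ <;>
    rcases q with _ | _ | _ | _ | ⟨_, h₂⟩ | ⟨_, h₂⟩ <;>
    rcases r with _ | _ | _ | _ | ⟨_, h₃⟩ | ⟨_, h₃⟩ <;>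
    simp only [HExt.inf, oldInf] <;> (try split_ifs) <;>
    simp only [le_def, HExt.le] at hp hq ⊢ <;> grind

noncomputable instance : Lattice (HExt G) where
  sup := HExt.sup
  inf := HExt.inf
  le_sup_left := HExt.le_sup_left
  le_sup_right p q := HExt.sup_comm p q ▸ HExt.le_sup_left q p
  sup_le _ _ _ := HExt.sup_le
  inf_le_left := HExt.inf_le_left
  inf_le_right p q := HExt.inf_comm p q ▸ HExt.inf_le_left q p
  le_inf _ _ _ := HExt.le_inf

end HExt

/-- A relation is a lattice congruence as soon as it is compatible with joins and meets by a
fixed element. -/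
lemma IsLatCon.of_unary {K : Type*} [Lattice K] {r : K → K → Prop} (h : Equivalence r)
    (hinf : ∀ p p' t, r p p' → r (p ⊓ t) (p' ⊓ t))
    (hsup : ∀ p p' t, r p p' → r (p ⊔ t) (p' ⊔ t)) : IsLatCon r := by
  refine ⟨h, fun a b c d hab hcd => h.trans (hinf _ _ c hab) ?_,
    fun a b c d hab hcd => h.trans (hsup _ _ c hab) ?_⟩
  · rw [inf_comm b, inf_comm b]
    exact hinf _ _ b hcd
  · rw [sup_comm b, sup_comm b]
    exact hsup _ _ b hcd

namespace HExt

variable {L : Type*} [Lattice L] {G : Gadget L}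

lemma sup_def (p q : HExt G) : p ⊔ q = HExt.sup p q := rfl

lemma inf_def (p q : HExt G) : p ⊓ q = HExt.inf p q := rfl

/-- The extension of a relation on `L` to `HExt G`. -/
def extRel (G : Gadget L) (θ : L → L → Prop) : HExt G → HExt G → Prop
  | old z, old z' => θ z z'
  | u y _, u y' _ => θ y y'
  | x t _, x t' _ => θ t t'
  | o, o => True
  | s, s => True
  | w, w => True
  | s, w => θ G.a G.b
  | w, s => θ G.a G.b
  | o, s => θ G.c G.d
  | s, o => θ G.c G.d
  | o, w => θ G.c G.d
  | w, o => θ G.c G.d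
  | _, _ => False

variable {θ : L → L → Prop}

lemma extRel_equivalence (hθ : IsLatCon θ) (hcd : θ G.c G.d → θ G.a G.b) :
    Equivalence (extRel G θ) where
  refl p := by cases p <;> simp [extRel, hθ.1.refl]
  symm {p q} := by
    have := fun y y' => hθ.1.symm (x := y) (y := y')
    cases p <;> cases q <;> simp only [extRel] <;> grind
  trans {p q r} := by
    have := fun y y' y'' => hθ.1.trans (x := y) (y := y') (z := y'')
    cases p <;> cases q <;> cases r <;> simp only [extRel] <;> grind

lemma extRel_mkU (hΨ : ∀ y y', θ y y' → G.Ψ y y') (hθ : IsLatCon θ) {y y' : L}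
    (h : G.a ≤ y) (h' : G.a ≤ y') (hy : θ y y') : extRel G θ (mkU G y) (mkU G y') := by
  have : G.InA y ↔ G.InA y' :=
    ⟨fun k => k.rel (hΨ _ _ hy) h', fun k => k.rel (hΨ _ _ (hθ.1.symm hy)) h⟩
  unfold mkU
  split_ifs <;> simp_all [extRel, hθ.1.refl]

lemma extRel_mkX (hΨ : ∀ y y', θ y y' → G.Ψ y y') (hθ : IsLatCon θ) {y y' : L}
    (h : G.c ≤ y) (h' : G.c ≤ y') (hy : θ y y') : extRel G θ (mkX G y) (mkX G y') := by
  have : G.InC y ↔ G.InC y' :=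
    ⟨fun k => k.rel (hΨ _ _ hy) h', fun k => k.rel (hΨ _ _ (hθ.1.symm hy)) h⟩
  unfold mkX
  split_ifs <;> simp_all [extRel, hθ.1.refl]

lemma u_eq_mkU {y : L} (h : G.InA y) : u y h = mkU G y := by simp [mkU, h]

lemma x_eq_mkX {y : L} (h : G.InC y) : x y h = mkX G y := by simp [mkX, h]

lemma extRel_inf (hθ : IsLatCon θ) (hΨ : ∀ y y', θ y y' → G.Ψ y y')
    (p p' t : HExt G) (h : extRel G θ p p') :
    extRel G θ (p ⊓ t) (p' ⊓ t) := by
  have hr := hθ.1.refl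
  have hs := fun y y' => hθ.1.symm (x := y) (y := y')
  have hinf : ∀ y y' z, θ y y' → θ (y ⊓ z) (y' ⊓ z) := fun y y' z h => hθ.2.1 _ _ _ _ h (hr z)
  have hinf' : ∀ y y' z, θ y y' → θ (z ⊓ y) (z ⊓ y') := fun y y' z h => hθ.2.1 _ _ _ _ (hr z) h
  have htop : ∀ z, θ G.top z → z = G.top := fun z h => G.top_isolated z (hΨ _ _ h)
  have hab : ∀ y y', G.InA y' → θ y y' → G.b ≤ y → ¬ G.b ≤ y' → θ G.a G.b := by
    intro y y' hy' h hb hb'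
    have h₁ := hinf _ _ G.b h
    rw [inf_eq_right.2 hb] at h₁
    rcases G.covby_ab.eq_or_eq (le_inf hy'.1 G.a_le_b) inf_le_right with h₂ | h₂
    · exact h₂ ▸ hs _ _ h₁
    · exact absurd (inf_eq_right.1 h₂) hb'
  have hcd' : ∀ y y', G.InC y' → θ y y' → G.d ≤ y → ¬ G.d ≤ y' → θ G.c G.d := by
    intro y y' hy' h hb hb'
    have h₁ := hinf _ _ G.d h
    rw [inf_eq_right.2 hb] at h₁
    rcases G.covby_cd.eq_or_eq (le_inf hy'.1 G.c_le_d) inf_le_right with h₂ | h₂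
    · exact h₂ ▸ hs _ _ h₁
    · exact absurd (inf_eq_right.1 h₂) hb'
  simp only [inf_def]
  rcases p with _ | _ | _ | _ | ⟨_, h₁⟩ | ⟨_, h₁⟩ <;>
    rcases p' with _ | _ | _ | _ | ⟨_, h₂⟩ | ⟨_, h₂⟩ <;>
    simp only [extRel] at h <;>
    rcases t with _ | _ | _ | _ | ⟨_, h₃⟩ | ⟨_, h₃⟩ <;>
    simp only [HExt.inf, oldInf] <;> (try split_ifs) <;> simp only [extRel] <;> grind

set_option maxHeartbeats 2000000 in
lemma extRel_sup (hθ : IsLatCon θ) (hΨ : ∀ y y', θ y y' → G.Ψ y y')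
    (hcd : θ G.c G.d → θ G.a G.b) (p p' t : HExt G) (h : extRel G θ p p') :
    extRel G θ (p ⊔ t) (p' ⊔ t) := by
  have hr := hθ.1.refl
  have hR := (extRel_equivalence hθ hcd).refl
  have hs := fun y y' => hθ.1.symm (x := y) (y := y')
  have hsup : ∀ y y' z, θ y y' → θ (y ⊔ z) (y' ⊔ z) := fun y y' z h => hθ.2.2 _ _ _ _ h (hr z)
  have hsup' : ∀ y y' z, θ y y' → θ (z ⊔ y) (z ⊔ y') := fun y y' z h => hθ.2.2 _ _ _ _ (hr z) h
  have hbot : ∀ z, θ G.bot z → z = G.bot := fun z h => G.bot_isolated z (hΨ _ _ h)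
  have hinC : ∀ z z', θ z z' → G.InC (G.c ⊔ z) → G.InC (G.c ⊔ z') := fun z z' h k =>
    k.rel (hΨ _ _ (hsup' _ _ _ h)) le_sup_left
  have hdc : ∀ z, G.InC (G.d ⊔ z) ↔ G.InC (G.c ⊔ z) := fun _ => Gadget.inC_d_sup_iff
  have := G.c_le_d
  have := G.a_le_b
  have hl : ∀ z y t : L, z ≤ y → z ≤ y ⊔ t := fun _ _ _ h => h.trans le_sup_left
  have hA : ∀ y, G.InA y → G.a ≤ y := fun y h => h.1
  have hC : ∀ y, G.InC y → G.c ≤ y := fun y h => h.1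
  have hb : ∀ y, θ G.a G.b → G.InA y → θ y (y ⊔ G.b) := fun y h k => by
    simpa [k.1] using hsup' _ _ y h
  have hd : ∀ y, θ G.c G.d → G.InC y → θ y (y ⊔ G.d) := fun y h k => by
    simpa [k.1] using hsup' _ _ y h
  have hU := fun y y' => extRel_mkU (y := y) (y' := y') hΨ hθ
  have hX := fun y y' => extRel_mkX (y := y) (y' := y') hΨ hθ
  have hO : ∀ z z', θ z z' → extRel G θ (old z) (old z') := fun _ _ h => h
  have hos : θ G.c G.d → extRel G θ o s ∧ extRel G θ o w ∧ extRel G θ s o ∧ extRel G θ w o :=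
    fun h => ⟨h, h, h, h⟩
  have hsw : θ G.a G.b → extRel G θ s w ∧ extRel G θ w s := fun h => ⟨h, h⟩
  simp only [sup_def]
  rcases p with _ | _ | _ | _ | ⟨_, h₁⟩ | ⟨_, h₁⟩ <;>
    rcases p' with _ | _ | _ | _ | ⟨_, h₂⟩ | ⟨_, h₂⟩ <;>
    simp only [extRel] at h <;>
    rcases t with _ | _ | _ | _ | ⟨_, h₃⟩ | ⟨_, h₃⟩ <;>
    simp only [HExt.sup, oldSup, u_eq_mkU, x_eq_mkX] <;> (try split_ifs) <;> grind

lemma isLatCon_extRel (hθ : IsLatCon θ) (hΨ : ∀ y y', θ y y' → G.Ψ y y')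
    (hcd : θ G.c G.d → θ G.a G.b) : IsLatCon (extRel G θ) :=
  .of_unary (extRel_equivalence hθ hcd) (extRel_inf hθ hΨ) (extRel_sup hθ hΨ hcd)

end HExt

lemma IsLatCon.full {K : Type*} [Lattice K] {r : K → K → Prop} (h : IsLatCon r) {bot top : K}
    (hb : ∀ z, bot ≤ z) (ht : ∀ z, z ≤ top) (hr : r bot top) (y z : K) : r y z := by
  have key : ∀ y, r bot y := fun y => by
    have := h.2.1 _ _ _ _ hr (h.1.refl y)
    rwa [inf_eq_left.2 (hb y), inf_eq_right.2 (ht y)] at this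
  exact h.1.trans (h.1.symm (key y)) (key z)

/-- Three elements which are both atoms and coatoms, each of them a complement of every other
proper element. -/
def IsSpread {K : Type*} [Lattice K] (bot top x₁ x₂ x₃ : K) : Prop :=
  x₁ ≠ x₂ ∧ x₁ ≠ x₃ ∧ x₂ ≠ x₃ ∧ ∀ x ∈ ({x₁, x₂, x₃} : Set K), bot ⋖ x ∧ x ⋖ top ∧
    ∀ y : K, y ≠ bot → y ≠ top → y ≠ x → x ⊓ y = bot ∧ x ⊔ y = top

section Spread

variable {K : Type*} [Lattice K] {bot top x₁ x₂ x₃ : K} {r : K → K → Prop}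

lemma IsLatCon.bot_top_of_rel_bot (h : IsLatCon r) (hb : ∀ z, bot ≤ z)
    (hx : IsSpread bot top x₁ x₂ x₃) {z : K} (hz : z ≠ bot) (hr : r bot z) : r bot top := by
  obtain ⟨h₁₂, h₁₃, h₂₃, hx⟩ := hx
  simp only [Set.mem_insert_iff, Set.mem_singleton_iff, forall_eq_or_imp, forall_eq] at hx
  obtain ⟨⟨c₁, d₁, e₁⟩, ⟨c₂, d₂, e₂⟩, ⟨c₃, d₃, e₃⟩⟩ := hx
  by_cases hzt : z = top
  · exact hzt ▸ hr
  have key : ∀ x, x ⊔ z = top → r x top := fun x hxz => by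
    have := h.2.2 _ _ _ _ (h.1.refl x) hr
    rwa [sup_eq_left.2 (hb x), hxz] at this
  have two : ∀ x y, x ⊔ z = top → y ⊔ z = top → x ⊓ y = bot → r bot top := fun x y h₁ h₂ h₃ => by
    simpa [h₃] using h.2.1 _ _ _ _ (key x h₁) (key y h₂)
  by_cases hz₁ : z = x₁
  · exact two x₂ x₃ (e₂ z hz hzt (hz₁ ▸ h₁₂)).2 (e₃ z hz hzt (hz₁ ▸ h₁₃)).2
      (e₂ x₃ c₃.lt.ne' d₃.lt.ne h₂₃.symm).1
  by_cases hz₂ : z = x₂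
  · exact two x₁ x₃ (e₁ z hz hzt hz₁).2 (e₃ z hz hzt (hz₂ ▸ h₂₃)).2
      (e₁ x₃ c₃.lt.ne' d₃.lt.ne h₁₃.symm).1
  · exact two x₁ x₂ (e₁ z hz hzt hz₁).2 (e₂ z hz hzt hz₂).2
      (e₁ x₂ c₂.lt.ne' d₂.lt.ne h₁₂.symm).1

lemma IsLatCon.bot_top_of_rel_top (h : IsLatCon r) (hb : ∀ z, bot ≤ z) (ht : ∀ z, z ≤ top)
    (hx : IsSpread bot top x₁ x₂ x₃) {z : K} (hz : z ≠ top) (hr : r top z) : r bot top := by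
  have hx' := hx
  obtain ⟨h₁₂, -, -, hx⟩ := hx
  simp only [Set.mem_insert_iff, Set.mem_singleton_iff, forall_eq_or_imp, forall_eq] at hx
  obtain ⟨⟨c₁, d₁, e₁⟩, ⟨c₂, d₂, e₂⟩, -⟩ := hx
  by_cases hzb : z = bot
  · exact h.1.symm (hzb ▸ hr)
  have key : ∀ x, bot ≠ x → x ⊓ z = bot → r bot top := fun x hxb hxz => by
    have := h.2.1 _ _ _ _ (h.1.refl x) hr
    rw [inf_eq_left.2 (ht x), hxz] at this
    exact h.bot_top_of_rel_bot hb hx' hxb.symm (h.1.symm this)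
  by_cases hz₁ : z = x₁
  · exact key x₂ c₂.lt.ne (e₂ z hzb hz (hz₁ ▸ h₁₂)).1
  · exact key x₁ c₁.lt.ne (e₁ z hzb hz hz₁).1

end Spread

namespace HExt

variable {L : Type*} [Lattice L] {G : Gadget L}

lemma old_inf_old (y z : L) : (old y ⊓ old z : HExt G) = old (y ⊓ z) := rfl

lemma old_sup_old (y z : L) : (old y ⊔ old z : HExt G) = old (y ⊔ z) := rfl

lemma old_le_old {y z : L} : (old y : HExt G) ≤ old z ↔ y ≤ z := Iff.rfl

lemma u_inf_old {y z : L} (h : G.InA y) (hz : z ≠ G.top) : u y h ⊓ old z = old (y ⊓ z) := by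
  simp [inf_def, HExt.inf, oldInf, hz]

lemma x_inf_old {y z : L} (h : G.InC y) (hz : z ≠ G.top) : x y h ⊓ old z = old (y ⊓ z) := by
  simp [inf_def, HExt.inf, oldInf, hz]

lemma o_inf_old {z : L} (hz : z ≠ G.top) : o ⊓ old z = (old G.bot : HExt G) := by
  simp [inf_def, HExt.inf, oldInf, hz]

lemma s_inf_old {z : L} (hz : z ≠ G.top) : s ⊓ old z = (old G.bot : HExt G) := by
  simp [inf_def, HExt.inf, oldInf, hz]

lemma w_inf_old {z : L} (hz : z ≠ G.top) : w ⊓ old z = (old G.bot : HExt G) := by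
  simp [inf_def, HExt.inf, oldInf, hz]

lemma old_inf_o {z : L} (hz : z ≠ G.top) : old z ⊓ o = (old G.bot : HExt G) := by
  simp [inf_def, HExt.inf, oldInf, hz]

lemma not_inC_c_sup {y : L} (h : G.InA y) : ¬ G.InC (G.c ⊔ y) := fun k => by
  rw [sup_comm, h.sup_eq_top Gadget.inC_c] at k
  exact k.ne_top rfl

lemma o_sup_old_of_inA {y : L} (h : G.InA y) : o ⊔ old y = u y h := by
  simp [sup_def, HExt.sup, oldSup, h.ne_bot, not_inC_c_sup h, mkU, h.1, h]

lemma s_sup_old_of_inA {y : L} (h : G.InA y) : s ⊔ old y = u y h := by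
  simp [sup_def, HExt.sup, oldSup, h.ne_bot, Gadget.inC_d_sup_iff, not_inC_c_sup h, mkU, h.1, h]

lemma w_sup_old_of_inA {y : L} (h : G.InA y) : w ⊔ old y = mkU G (G.b ⊔ y) := by
  simp [sup_def, HExt.sup, oldSup, h.ne_bot, Gadget.inC_d_sup_iff, not_inC_c_sup h]

lemma o_sup_old_of_inC {y : L} (h : G.InC y) : o ⊔ old y = x y h := by
  simp [sup_def, HExt.sup, oldSup, h.ne_bot, mkX, h.1, h]

lemma s_sup_old_of_inC {y : L} (h : G.InC y) : s ⊔ old y = mkX G (G.d ⊔ y) := by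
  simp [sup_def, HExt.sup, oldSup, h.ne_bot, Gadget.inC_d_sup_iff, h.1, h]

lemma w_sup_old_of_inC {y : L} (h : G.InC y) : w ⊔ old y = mkX G (G.d ⊔ y) := by
  simp [sup_def, HExt.sup, oldSup, h.ne_bot, Gadget.inC_d_sup_iff, h.1, h]

lemma _root_.IsSpread.sup_eq_top {x₁ x₂ x₃ : L} (hx : IsSpread G.bot G.top x₁ x₂ x₃) {e : L}
    (he : e ∈ ({x₁, x₂, x₃} : Set L)) :
    (∀ y, G.InA y → e ≠ y ∧ y ⊔ e = G.top) ∧ (∀ t, G.InC t → e ≠ t ∧ t ⊔ e = G.top) := by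
  obtain ⟨-, -, -, hx⟩ := hx
  obtain ⟨h₁, h₂, h₃⟩ := hx e he
  have ha : G.a ≠ e := fun h =>
    h₂.2 (h ▸ G.covby_ab.lt) (lt_of_le_of_ne (G.le_top _) Gadget.inA_b.ne_top)
  have hc : G.c ≠ e := fun h =>
    h₂.2 (h ▸ G.covby_cd.lt) (lt_of_le_of_ne (G.le_top _) Gadget.inC_d.ne_top)
  have ha' : G.a ⊔ e = G.top := by
    rw [sup_comm]
    exact (h₃ _ Gadget.inA_a.ne_bot Gadget.inA_a.ne_top ha).2
  have hc' : G.c ⊔ e = G.top := by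
    rw [sup_comm]
    exact (h₃ _ Gadget.inC_c.ne_bot Gadget.inC_c.ne_top hc).2
  refine ⟨fun y hy => ⟨?_, G.eq_top_of_le (ha' ▸ sup_le_sup_right hy.1 e)⟩,
    fun y hy => ⟨?_, G.eq_top_of_le (hc' ▸ sup_le_sup_right hy.1 e)⟩⟩
  · rintro rfl
    exact hy.ne_top (by rw [← ha', sup_eq_right.2 hy.1])
  · rintro rfl
    exact hy.ne_top (by rw [← hc', sup_eq_right.2 hy.1])

lemma not_inA_top : ¬ G.InA G.top := fun h => h.ne_top rfl

lemma not_inC_top : ¬ G.InC G.top := fun h => h.ne_top rfl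

lemma mkU_top : mkU G G.top = old G.top := by simp [mkU, not_inA_top]

lemma mkX_top : mkX G G.top = old G.top := by simp [mkX, not_inC_top]

lemma _root_.IsSpread.old_sup_o {x₁ x₂ x₃ : L} (hx : IsSpread G.bot G.top x₁ x₂ x₃) {e : L}
    (he : e ∈ ({x₁, x₂, x₃} : Set L)) : old e ⊔ o = (old G.top : HExt G) := by
  have h₁ := ((hx.sup_eq_top he).1 _ Gadget.inA_a).2
  have h₂ := ((hx.sup_eq_top he).2 _ Gadget.inC_c).2
  simp [sup_def, HExt.sup, oldSup, (hx.2.2.2 e he).1.lt.ne', h₁, h₂, mkU_top, not_inC_top]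

variable {r : HExt G → HExt G → Prop} (hr : IsLatCon r)
include hr

lemma isLatCon_restrict : IsLatCon fun y z => r (old y) (old z) :=
  ⟨⟨fun _ => hr.1.refl _, hr.1.symm, hr.1.trans⟩, fun _ _ _ _ => hr.2.1 _ _ _ _,
    fun _ _ _ _ => hr.2.2 _ _ _ _⟩

lemma rel_inf {p p' : HExt G} (h : r p p') (t : HExt G) : r (p ⊓ t) (p' ⊓ t) :=
  hr.2.1 _ _ _ _ h (hr.1.refl t)

lemma rel_sup {p p' : HExt G} (h : r p p') (t : HExt G) : r (t ⊔ p) (t ⊔ p') :=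
  hr.2.2 _ _ _ _ (hr.1.refl t) h

lemma rel_u_iff {y y' : L} (h : G.InA y) (h' : G.InA y') :
    r (u y h) (u y' h') ↔ r (old y) (old y') := by
  refine ⟨fun k => ?_, fun k => ?_⟩
  · simpa [u_inf_old, (h.sup h').ne_top] using rel_inf hr k (old (y ⊔ y'))
  · simpa [o_sup_old_of_inA, h, h'] using rel_sup hr k o

lemma rel_x_iff {y y' : L} (h : G.InC y) (h' : G.InC y') :
    r (x y h) (x y' h') ↔ r (old y) (old y') := by
  refine ⟨fun k => ?_, fun k => ?_⟩
  · simpa [x_inf_old, (h.sup h').ne_top] using rel_inf hr k (old (y ⊔ y'))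
  · simpa [o_sup_old_of_inC, h, h'] using rel_sup hr k o

lemma rel_s_w_iff : r s w ↔ r (old G.a) (old G.b) := by
  refine ⟨fun k => ?_, fun k => ?_⟩
  · have := rel_sup hr k (old G.a)
    rw [sup_comm, s_sup_old_of_inA Gadget.inA_a, sup_comm, w_sup_old_of_inA Gadget.inA_a,
      sup_eq_left.2 G.a_le_b, ← u_eq_mkU Gadget.inA_b] at this
    exact (rel_u_iff hr _ _).1 this
  · have := rel_inf hr ((rel_u_iff hr Gadget.inA_a Gadget.inA_b).2 k) w
    simpa [inf_def, HExt.inf, G.covby_ab.lt.not_ge] using this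

lemma rel_o_s_iff : r o s ↔ r (old G.c) (old G.d) := by
  refine ⟨fun k => ?_, fun k => ?_⟩
  · have := rel_sup hr k (old G.c)
    rw [sup_comm, o_sup_old_of_inC Gadget.inC_c, sup_comm, s_sup_old_of_inC Gadget.inC_c,
      sup_eq_left.2 G.c_le_d, ← x_eq_mkX Gadget.inC_d] at this
    exact (rel_x_iff hr _ _).1 this
  · have := rel_inf hr ((rel_x_iff hr Gadget.inC_c Gadget.inC_d).2 k) s
    simpa [inf_def, HExt.inf, G.covby_cd.lt.not_ge] using this

lemma rel_o_w_iff : r o w ↔ r (old G.c) (old G.d) := by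
  refine ⟨fun k => ?_, fun k => ?_⟩
  · have := rel_sup hr k (old G.c)
    rw [sup_comm, o_sup_old_of_inC Gadget.inC_c, sup_comm, w_sup_old_of_inC Gadget.inC_c,
      sup_eq_left.2 G.c_le_d, ← x_eq_mkX Gadget.inC_d] at this
    exact (rel_x_iff hr _ _).1 this
  · have := rel_inf hr ((rel_x_iff hr Gadget.inC_c Gadget.inC_d).2 k) w
    simpa [inf_def, HExt.inf, G.covby_cd.lt.not_ge] using this

/-- Collapsing `[c, d]` in the extension collapses `[a, b]`. -/
lemma rel_ab_of_rel_cd (h : r (old G.c) (old G.d)) : r (old G.a) (old G.b) := by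
  have := rel_sup hr ((rel_o_w_iff hr).2 h) (old G.a)
  rw [sup_comm, o_sup_old_of_inA Gadget.inA_a, sup_comm, w_sup_old_of_inA Gadget.inA_a,
    sup_eq_left.2 G.a_le_b, ← u_eq_mkU Gadget.inA_b] at this
  exact (rel_u_iff hr _ _).1 this

/-- A congruence collapsing a comparable pair of elements of different sorts is full. -/
lemma rel_bot_top {x₁ x₂ x₃ : L} (hx : IsSpread G.bot G.top x₁ x₂ x₃) {p p' : HExt G}
    (hle : p ≤ p') (h : r p p') (hne : ¬ extRel G (fun _ _ => True) p p') :
    r (old G.bot) (old G.top) := by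
  have hr' := isLatCon_restrict hr
  have hbot : ∀ z, z ≠ G.bot → r (old G.bot) (old z) → r (old G.bot) (old G.top) := fun z =>
    hr'.bot_top_of_rel_bot G.bot_le hx
  have htop : ∀ z, z ≠ G.top → r (old G.top) (old z) → r (old G.bot) (old G.top) := fun z =>
    hr'.bot_top_of_rel_top G.bot_le G.le_top hx
  have hold : ∀ z n, z ≠ G.top → n ⊓ o = o → r (old z) n → r (old G.bot) (old G.top) := by
    intro z n hz hn h
    have h₁ := rel_inf hr h o
    rw [old_inf_o hz, hn] at h₁
    have hx₁ : x₁ ∈ ({x₁, x₂, x₃} : Set L) := by simp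
    have h₂ := rel_sup hr h₁ (old x₁)
    rw [hx.old_sup_o hx₁, old_sup_old, sup_eq_left.2 (G.bot_le _)] at h₂
    exact htop x₁ (hx.2.2.2 x₁ hx₁).2.1.lt.ne (hr.1.symm h₂)
  have hc : ∀ n n', n ⊓ old G.c = old G.bot → n' ⊓ old G.c = old G.c → r n n' →
      r (old G.bot) (old G.top) := by
    intro n n' hn hn' h
    have := rel_inf hr h (old G.c)
    rw [hn, hn'] at this
    exact hbot _ Gadget.inC_c.ne_bot this
  have ha : ∀ n n', n ⊓ old G.a = old G.bot → n' ⊓ old G.a = old G.a → r n n' →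
      r (old G.bot) (old G.top) := by
    intro n n' hn hn' h
    have := rel_inf hr h (old G.a)
    rw [hn, hn'] at this
    exact hbot _ Gadget.inA_a.ne_bot this
  have hat := (Gadget.inA_a (G := G)).ne_top
  have hct := (Gadget.inC_c (G := G)).ne_top
  have hA : ∀ y hy, u y hy ⊓ old G.c = old G.bot := fun y hy => by
    rw [u_inf_old _ hct, hy.inf_eq_bot Gadget.inC_c]
  have hC : ∀ y hy, x y hy ⊓ old G.a = old G.bot := fun y hy => by
    rw [x_inf_old _ hat, inf_comm, Gadget.inA_a.inf_eq_bot hy]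
  have hA' : ∀ y hy, u y hy ⊓ old G.a = old G.a := fun y hy => by
    rw [u_inf_old _ hat, inf_eq_right.2 hy.1]
  have hC' : ∀ y hy, x y hy ⊓ old G.c = old G.c := fun y hy => by
    rw [x_inf_old _ hct, inf_eq_right.2 hy.1]
  have hnc := o_inf_old (G := G) hct
  have hna := o_inf_old (G := G) hat
  have hsc := s_inf_old (G := G) hct
  have hsa := s_inf_old (G := G) hat
  have hwc := w_inf_old (G := G) hct
  have hwa := w_inf_old (G := G) hat
  have hoo : ∀ z, old z ⊓ old G.top = old (G := G) z := fun z =>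
    congrArg old (inf_eq_left.2 (G.le_top z))
  have htc : old G.top ⊓ old G.c = (old G.c : HExt G) := congrArg old (inf_eq_right.2 (G.le_top _))
  have hta : old G.top ⊓ old G.a = (old G.a : HExt G) := congrArg old (inf_eq_right.2 (G.le_top _))
  have ho : ∀ n : HExt G, o ≤ n → n ⊓ o = o := fun n => inf_eq_right.2
  have hut : ∀ z y, z ≤ y → G.InA y → z ≠ G.top := fun z y hz hy hz' =>
    hy.ne_top (G.eq_top_of_le (hz' ▸ hz))
  have hxt : ∀ z y, z ≤ y → G.InC y → z ≠ G.top := fun z y hz hy hz' =>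
    hy.ne_top (G.eq_top_of_le (hz' ▸ hz))
  have := G.bot_ne_top
  rcases p with _ | _ | _ | _ | ⟨_, h₁⟩ | ⟨_, h₁⟩ <;>
    rcases p' with _ | _ | _ | _ | ⟨_, h₂⟩ | ⟨_, h₂⟩ <;>
    simp only [extRel, not_true_eq_false] at hne <;>
    simp only [le_def, HExt.le] at hle ho <;> grind

end HExt

section Congruences

variable {L : Type*} [Lattice L]

lemma isLatCon_cgSet (S : Set (L × L)) : IsLatCon (cgSet S) :=
  ⟨⟨fun _ _ hr _ => hr.1.refl _, fun h r hr hS => hr.1.symm (h r hr hS),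
    fun h h' r hr hS => hr.1.trans (h r hr hS) (h' r hr hS)⟩,
    fun _ _ _ _ h h' r hr hS => hr.2.1 _ _ _ _ (h r hr hS) (h' r hr hS),
    fun _ _ _ _ h h' r hr hS => hr.2.2 _ _ _ _ (h r hr hS) (h' r hr hS)⟩

lemma isLatCon_cg (a b : L) : IsLatCon (cg a b) :=
  ⟨⟨fun _ _ hr _ => hr.1.refl _, fun h r hr hS => hr.1.symm (h r hr hS),
    fun h h' r hr hS => hr.1.trans (h r hr hS) (h' r hr hS)⟩,
    fun _ _ _ _ h h' r hr hS => hr.2.1 _ _ _ _ (h r hr hS) (h' r hr hS),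
    fun _ _ _ _ h h' r hr hS => hr.2.2 _ _ _ _ (h r hr hS) (h' r hr hS)⟩

lemma cg_self (a b : L) : cg a b a b := fun _ _ h => h

/-- The join of two congruences. -/
def conJoin (r₁ r₂ : L → L → Prop) : L → L → Prop :=
  Relation.ReflTransGen fun y z => r₁ y z ∨ r₂ y z

variable {r₁ r₂ : L → L → Prop}

lemma isLatCon_conJoin (h₁ : IsLatCon r₁) (h₂ : IsLatCon r₂) : IsLatCon (conJoin r₁ r₂) := by
  refine .of_unary ⟨fun _ => .refl, fun h => ?_, fun h h' => h.trans h'⟩ (fun y z t h => ?_)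
    (fun y z t h => ?_) <;> induction h with
  | refl => exact .refl
  | tail _ k ih => ?_
  · exact Relation.ReflTransGen.head (k.imp h₁.1.symm h₂.1.symm) ih
  · exact ih.tail (k.imp (fun k => h₁.2.1 _ _ _ _ k (h₁.1.refl t))
      fun k => h₂.2.1 _ _ _ _ k (h₂.1.refl t))
  · exact ih.tail (k.imp (fun k => h₁.2.2 _ _ _ _ k (h₁.1.refl t))
      fun k => h₂.2.2 _ _ _ _ k (h₂.1.refl t))

/-- A prime interval collapsed by a join of two congruences is collapsed by one of them. -/
lemma conJoin_of_covBy (h₁ : IsLatCon r₁) (h₂ : IsLatCon r₂) {y z : L} (hyz : y ⋖ z)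
    (h : conJoin r₁ r₂ y z) : r₁ y z ∨ r₂ y z := by
  by_contra! hc
  have key : ∀ t, conJoin r₁ r₂ y t → (t ⊔ y) ⊓ z = y := fun t ht => by
    induction ht with
    | refl => simp [hyz.le]
    | @tail t t' _ htt' ih =>
      rcases hyz.eq_or_eq (le_inf le_sup_right hyz.le : y ≤ (t' ⊔ y) ⊓ z) inf_le_right with h | h
      · exact h
      · have aux : ∀ r : L → L → Prop, IsLatCon r → r t t' → r y z := fun r hr ht => by
          have := hr.2.1 _ _ _ _ (hr.2.2 _ _ _ _ ht (hr.1.refl y)) (hr.1.refl z)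
          rwa [ih, h] at this
        exact (htt'.elim (fun k => hc.1 (aux _ h₁ k)) (fun k => hc.2 (aux _ h₂ k))).elim
  have := key z h
  rw [inf_eq_right.2 le_sup_left] at this
  exact hyz.lt.ne' this

end Congruences

namespace AuxStr

variable {L H : Type*} [Lattice L] (A : AuxStr L H)

lemma nu_refl (h : H) : A.ν h h := A.quasi.1 h

lemma delta_le (h : H) : A.δ h ≤ A.ε h := by
  by_cases hz : h = A.zero
  · exact hz ▸ A.delta_zero.le
  · exact (A.delta_covby h hz).le

variable {A}

lemma nu_trans {h h' h'' : H} (k : A.ν h h') (k' : A.ν h' h'') : A.ν h h'' := A.quasi.2.1 k k'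

variable {r : L → L → Prop}

lemma rel_of_nu (hr : IsLatCon r) {y z y' z' : L} (hyz : y ≤ z) (hyz' : y' ≤ z')
    (h : A.ν (A.γ y z) (A.γ y' z')) (k : r y' z') : r y z :=
  A.quasi.2.2.2.1 _ _ _ _ hyz hyz' h _ _ (cg_self y z) r hr k

lemma rel_delta_of_nu (hr : IsLatCon r) {h h' : H} (hh : A.ν h h')
    (k : r (A.δ h') (A.ε h')) : r (A.δ h) (A.ε h) :=
  rel_of_nu hr (A.delta_le h) (A.delta_le h') (by rwa [A.gamma_delta, A.gamma_delta]) k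

/-- A congruence collapses a pair iff it collapses the prime interval of its colour. -/
lemma rel_iff (hr : IsLatCon r) {y z : L} (hyz : y ≤ z) :
    r y z ↔ r (A.δ (A.γ y z)) (A.ε (A.γ y z)) :=
  ⟨rel_of_nu hr (A.delta_le _) hyz (by rw [A.gamma_delta]; exact A.nu_refl _),
    rel_of_nu hr hyz (A.delta_le _) (by rw [A.gamma_delta]; exact A.nu_refl _)⟩

lemma cg_iff {h h' : H} : cg (A.δ h) (A.ε h) (A.δ h') (A.ε h') ↔ A.ν h' h := by
  refine ⟨fun k => ?_, fun k => rel_delta_of_nu (isLatCon_cg _ _) k (cg_self _ _)⟩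
  have := A.quasi.2.2.2.2 _ _ _ _ (A.delta_le h') (A.delta_le h)
    (fun y z hyz r hr hr' => hyz r hr (k r hr hr'))
  rwa [A.gamma_delta, A.gamma_delta] at this

/-- The quasiorder of `A` enlarged by the pair `(p, q)`. -/
def nuExt (A : AuxStr L H) (p q h h' : H) : Prop := A.ν h h' ∨ (A.ν h p ∧ A.ν q h')

variable {p q : H}

lemma nuExt_refl (h : H) : A.nuExt p q h h := .inl (A.nu_refl h)

lemma nuExt_trans {h h' h'' : H} (k : A.nuExt p q h h') (k' : A.nuExt p q h' h'') :
    A.nuExt p q h h'' := by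
  rcases k with k | ⟨k₁, k₂⟩ <;> rcases k' with k' | ⟨k₁', k₂'⟩
  exacts [.inl (nu_trans k k'), .inr ⟨nu_trans k k₁', k₂'⟩, .inr ⟨k₁, nu_trans k₂ k'⟩,
    .inr ⟨k₁, k₂'⟩]

lemma nuExt_eq_quoClosure :
    A.nuExt p q = quoClosure fun x y => A.ν x y ∨ (x = p ∧ y = q) := by
  ext h h'
  refine ⟨fun k μ hμ hμ' hR => ?_, fun k => k _ nuExt_refl (fun _ _ _ => nuExt_trans) ?_⟩
  · rcases k with k | ⟨k₁, k₂⟩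
    · exact hR _ _ (.inl k)
    · exact hμ' (hR _ _ (.inl k₁)) (hμ' (hR _ _ (.inr ⟨rfl, rfl⟩)) (hR _ _ (.inl k₂)))
  · rintro x y (k | ⟨rfl, rfl⟩)
    exacts [.inl k, .inr ⟨A.nu_refl _, A.nu_refl _⟩]

/-- For every colour `h` some congruence collapses exactly the colours below `h` in the
enlarged quasiorder. -/
lemma exists_con {Ψ : L → L → Prop} (hΨ : IsLatCon Ψ) {h : H}
    (hh : Ψ (A.δ h) (A.ε h)) (hp : Ψ (A.δ p) (A.ε p)) :
    ∃ M : L → L → Prop, IsLatCon M ∧ (∀ y z, M y z → Ψ y z) ∧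
      (M (A.δ q) (A.ε q) → M (A.δ p) (A.ε p)) ∧
      ∀ y z, y ≤ z → (M y z ↔ A.nuExt p q (A.γ y z) h) := by
  have hcg : ∀ h, Ψ (A.δ h) (A.ε h) → ∀ y z, cg (A.δ h) (A.ε h) y z → Ψ y z :=
    fun h hh y z k => k Ψ hΨ hh
  by_cases hq : A.ν q h
  · have hJ := isLatCon_conJoin (isLatCon_cg (A.δ h) (A.ε h)) (isLatCon_cg (A.δ p) (A.ε p))
    refine ⟨_, hJ, fun y z k => ?_, fun _ => .single (.inr (cg_self _ _)), fun y z hyz => ?_⟩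
    · induction k with
      | refl => exact hΨ.1.refl y
      | tail _ k ih => exact hΨ.1.trans ih (k.elim (hcg h hh _ _) (hcg p hp _ _))
    · rw [rel_iff hJ hyz]
      by_cases hz : A.γ y z = A.zero
      · rw [hz, A.delta_zero]
        exact ⟨fun _ => .inl (A.zero_least h), fun _ => .refl⟩
      · refine ⟨fun k => ?_, fun k => .single ?_⟩
        · exact (conJoin_of_covBy (isLatCon_cg _ _) (isLatCon_cg _ _) (A.delta_covby _ hz) k).imp
            cg_iff.1 fun k => ⟨cg_iff.1 k, hq⟩
        · exact k.imp cg_iff.2 fun k => cg_iff.2 k.1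
  · have hC := isLatCon_cg (A.δ h) (A.ε h)
    refine ⟨_, hC, hcg h hh, fun k => (hq (cg_iff.1 k)).elim, fun y z hyz => ?_⟩
    rw [rel_iff hC hyz, cg_iff]
    exact ⟨.inl, fun k => k.elim id fun k => (hq k.2).elim⟩

end AuxStr

section Quadruple

variable {L : Type*} [Lattice L] {a₁ b₁ a₂ b₂ : L}

lemma IsN6.right_ne_sup (h : IsN6 a₁ b₁ a₂ b₂) : b₁ ≠ a₁ ⊔ a₂ := fun k => by
  obtain ⟨-, h₂, h₃, h₄, -⟩ := h
  have : b₂ ≤ b₁ := by rw [k, h₄]; exact le_sup_right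
  rw [inf_eq_right.2 this] at h₃
  exact h₂.not_ge (h₃ ▸ inf_le_right)

lemma IsN6.left_ne_inf (h : IsN6 a₁ b₁ a₂ b₂) : a₁ ≠ a₁ ⊓ a₂ := fun k => by
  obtain ⟨-, h₂, -, h₄, -⟩ := h
  rw [sup_eq_right.2 (left_eq_inf.1 k)] at h₄
  exact h₂.not_ge (h₄ ▸ le_sup_right)

lemma IsN6.swap (h : IsN6 a₁ b₁ a₂ b₂) : IsN6 a₂ b₂ a₁ b₁ := by
  obtain ⟨h₁, h₂, h₃, h₄, h₅⟩ := h
  have : ({a₂ ⊓ a₁, a₂, b₂, a₁, b₁, a₂ ⊔ a₁} : Set L) =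
      {a₁ ⊓ a₂, a₁, b₁, a₂, b₂, a₁ ⊔ a₂} := by
    rw [inf_comm, sup_comm]
    ext z
    simp only [Set.mem_insert_iff, Set.mem_singleton_iff]
    tauto
  refine ⟨h₂, h₁, by rw [inf_comm, h₃, inf_comm], by rw [sup_comm, h₄, sup_comm], ?_⟩
  rwa [this]

end Quadruple

/-- Two incomparable colours whose prime intervals form a spanning N₆-quadruple. -/
structure AuxStr.IsHorizontal {L H : Type*} [Lattice L] (A : AuxStr L H) (p q : H) : Prop where
  not_nu : ¬ A.ν p q
  not_nu' : ¬ A.ν q p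
  spanning : IsSpanningN6 (A.δ p) (A.ε p) (A.δ q) (A.ε q)

namespace AuxStr.IsHorizontal

variable {L H : Type*} [Lattice L] {A : AuxStr L H} {p q : H}

lemma ne_zero_left (S : A.IsHorizontal p q) : p ≠ A.zero := fun h =>
  S.not_nu (h ▸ A.zero_least q)

lemma ne_zero_right (S : A.IsHorizontal p q) : q ≠ A.zero := fun h =>
  S.not_nu' (h ▸ A.zero_least p)

lemma ne (S : A.IsHorizontal p q) : p ≠ q := fun h => S.not_nu (h ▸ A.nu_refl p)

/-- The colour of the pair of bounds. -/
def one (_ : A.IsHorizontal p q) : H := A.γ (A.ε p ⊓ A.ε q) (A.δ p ⊔ A.δ q)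

variable (S : A.IsHorizontal p q)
include S

lemma isBot : IsBot (A.ε p ⊓ A.ε q) := S.spanning.2.1

lemma isTop : IsTop (A.δ p ⊔ A.δ q) := S.spanning.2.2

lemma nu_one (h : H) : A.ν h S.one := by
  have := A.quasi.2.2.2.2 _ _ _ _ (A.delta_le h) (S.isBot (A.δ p ⊔ A.δ q))
    (fun y z _ r hr hr' => hr.full S.isBot S.isTop hr' y z)
  rwa [A.gamma_delta] at this

lemma ne_one_left : p ≠ S.one := fun h => S.not_nu' (h ▸ S.nu_one q)

lemma ne_one_right : q ≠ S.one := fun h => S.not_nu (h ▸ S.nu_one p)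

lemma eq_one {h : H} (hh : A.ν S.one h) : h = S.one :=
  A.greatest_unique _ _ (fun _ => nu_trans (S.nu_one _) hh) S.nu_one

lemma bot_ne_top : A.ε p ⊓ A.ε q ≠ A.δ p ⊔ A.δ q := fun h =>
  (A.delta_covby p S.ne_zero_left).lt.not_ge ((S.isTop _).trans (h ▸ (S.isBot _)))

lemma exists_isSpread : ∃ x₁ x₂ x₃, IsSpread (A.ε p ⊓ A.ε q) (A.δ p ⊔ A.δ q) x₁ x₂ x₃ :=
  A.atoms3 _ _ S.isBot S.isTop S.bot_ne_top

/-- The congruence generated by the pairs of colour different from the greatest one. -/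
def psi : L → L → Prop := cgSet {w : L × L | ∃ h : H, h ≠ S.one ∧ w = (A.δ h, A.ε h)}

lemma isLatCon_psi : IsLatCon S.psi := isLatCon_cgSet _

lemma psi_delta {h : H} (hh : h ≠ S.one) : S.psi (A.δ h) (A.ε h) :=
  fun _ _ hr => hr _ ⟨h, hh, rfl⟩

lemma not_psi : ¬ S.psi (A.ε p ⊓ A.ε q) (A.δ p ⊔ A.δ q) := fun h => by
  obtain ⟨y, z, hyz⟩ := A.notfull S.one S.nu_one ⟨_, _, S.bot_ne_top⟩
  exact hyz (S.isLatCon_psi.full S.isBot S.isTop h y z)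

/-- The gadget of two incomparable colours. -/
def gadget : Gadget L where
  bot := A.ε p ⊓ A.ε q
  top := A.δ p ⊔ A.δ q
  a := A.δ p
  b := A.ε p
  c := A.δ q
  d := A.ε q
  Ψ := S.psi
  con := S.isLatCon_psi
  bot_le := S.isBot
  le_top := S.isTop
  covby_ab := A.delta_covby p S.ne_zero_left
  covby_cd := A.delta_covby q S.ne_zero_right
  rel_ab := S.psi_delta S.ne_one_left
  rel_cd := S.psi_delta S.ne_one_right
  bot_isolated z hz := by
    obtain ⟨_, _, _, hx⟩ := S.exists_isSpread
    by_contra h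
    exact S.not_psi (S.isLatCon_psi.bot_top_of_rel_bot S.isBot hx h hz)
  top_isolated z hz := by
    obtain ⟨_, _, _, hx⟩ := S.exists_isSpread
    by_contra h
    exact S.not_psi (S.isLatCon_psi.bot_top_of_rel_top S.isBot S.isTop hx h hz)
  inf_ac := S.spanning.1.2.2.1
  sup_ac := rfl
  strong z hz hzc := (A.strong p q S.not_nu S.not_nu' S.spanning).2.2.1 z
    (lt_of_le_of_ne (S.isBot z) hz.symm) (hzc.trans (A.delta_le q))

lemma eps_ne_top {h : H} (hh : h ≠ A.zero) : A.ε h ≠ A.δ p ⊔ A.δ q := by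
  intro hk
  have key : ∀ k, k ≠ A.zero → h ≠ k → False := fun k hk₀ hhk => by
    have h₆ := A.n6 h k hh hk₀ hhk
    refine h₆.right_ne_sup (le_antisymm ?_ (hk ▸ S.isTop _))
    rw [h₆.2.2.2.1]
    exact le_sup_left
  by_cases hp : h = p
  · exact key q S.ne_zero_right (hp ▸ S.ne)
  · exact key p S.ne_zero_left hp

open HExt

/-- The colouring of the extension. -/
def col : HExt S.gadget → HExt S.gadget → H
  | old y, old z => A.γ y z
  | u y _, u z _ => A.γ y z
  | x y _, x z _ => A.γ y z
  | s, w => p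
  | o, s => q
  | o, w => q
  | o, o => A.zero
  | s, s => A.zero
  | w, w => A.zero
  | _, _ => S.one

lemma rel_col_iff {r : HExt S.gadget → HExt S.gadget → Prop} (hr : IsLatCon r)
    {n n' : HExt S.gadget} (hn : n ≤ n') :
    r n n' ↔ r (old (A.δ (S.col n n'))) (old (A.ε (S.col n n'))) := by
  have hr' := isLatCon_restrict hr
  obtain ⟨_, _, _, hx⟩ := S.exists_isSpread
  have hone : r (old (A.δ S.one)) (old (A.ε S.one)) →
      r (old S.gadget.bot) (old S.gadget.top) :=
    (rel_iff hr' (S.isBot (A.δ p ⊔ A.δ q))).2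
  have hfull : r (old S.gadget.bot) (old S.gadget.top) → ∀ n n', r n n' := by
    refine hr.full (fun n => ?_) le_old_top
    have := S.gadget.bot_le
    cases n <;> simp [le_def, HExt.le, this]
  have hzero : r (old (A.δ A.zero)) (old (A.ε A.zero)) := by
    rw [A.delta_zero]
    exact hr.1.refl _
  have hγ := fun y z => rel_iff (A := A) hr' (y := y) (z := z)
  by_cases hne : extRel S.gadget (fun _ _ => True) n n'
  · rcases n with _ | _ | _ | _ | ⟨_, h₁⟩ | ⟨_, h₁⟩ <;>
    rcases n' with _ | _ | _ | _ | ⟨_, h₂⟩ | ⟨_, h₂⟩ <;>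
    first
    | exact hne.elim
    | exact hn.elim
    | exact hγ _ _ hn
    | exact (rel_u_iff hr h₁ h₂).trans (hγ _ _ hn)
    | exact (rel_x_iff hr h₁ h₂).trans (hγ _ _ hn)
    | exact rel_s_w_iff hr
    | exact rel_o_s_iff hr
    | exact rel_o_w_iff hr
    | exact iff_of_true (hr.1.refl _) hzero
  · have hcol : S.col n n' = S.one := by
      rcases n with _ | _ | _ | _ | ⟨_, h₁⟩ | ⟨_, h₁⟩ <;>
      rcases n' with _ | _ | _ | _ | ⟨_, h₂⟩ | ⟨_, h₂⟩ <;>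
      first
      | rfl
      | exact (hne trivial).elim
    rw [hcol]
    exact ⟨fun h => hfull (rel_bot_top hr hx hn h hne) _ _, fun h => hfull (hone h) _ _⟩

lemma isQuasiColored_col : IsQuasiColored S.col (A.nuExt p q) := by
  refine ⟨nuExt_refl, fun _ _ _ => nuExt_trans, fun h => ?_, ?_, ?_⟩
  · exact ⟨old (A.δ h), old (A.ε h), A.delta_le h, A.gamma_delta h⟩
  · intro n₁ n₁' n₂ n₂' h₁ h₂ hν y z k r hr hr'
    rw [S.rel_col_iff hr h₂] at hr'
    have hres := isLatCon_restrict hr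
    refine k r hr ((S.rel_col_iff hr h₁).2 ?_)
    rcases hν with hν | ⟨hν₁, hν₂⟩
    · exact rel_delta_of_nu hres hν hr'
    · exact rel_delta_of_nu hres hν₁ (rel_ab_of_rel_cd hr (rel_delta_of_nu hres hν₂ hr'))
  · intro n₁ n₁' n₂ n₂' h₁ h₂ hcg
    by_cases hone : S.col n₂ n₂' = S.one
    · exact hone ▸ .inl (S.nu_one _)
    obtain ⟨M, hM, hMΨ, hcd, hMγ⟩ := exists_con (p := p) (q := q) S.isLatCon_psi
      (S.psi_delta hone) (S.psi_delta S.ne_one_left)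
    have hr := isLatCon_extRel (G := S.gadget) hM hMΨ hcd
    have key : ∀ {n n'}, n ≤ n' →
        (extRel S.gadget M n n' ↔ A.nuExt p q (S.col n n') (S.col n₂ n₂')) := fun {n n'} hn => by
      have := hMγ _ _ (A.delta_le (S.col n n'))
      rw [A.gamma_delta] at this
      exact (S.rel_col_iff hr hn).trans this
    exact (key h₁).1 (hcg _ _ (cg_self _ _) _ hr ((key h₂).2 (nuExt_refl _)))

end AuxStr.IsHorizontal

lemma IsN6.map {L K : Type*} [Lattice L] [Lattice K] {f : L → K} (hf : Function.Injective f)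
    (hinf : ∀ y z, f (y ⊓ z) = f y ⊓ f z) (hsup : ∀ y z, f (y ⊔ z) = f y ⊔ f z) {a₁ b₁ a₂ b₂ : L}
    (h : IsN6 a₁ b₁ a₂ b₂) : IsN6 (f a₁) (f b₁) (f a₂) (f b₂) := by
  have hlt : ∀ {y z}, y < z → f y < f z := fun {y z} hyz =>
    lt_of_le_of_ne (by rw [← inf_eq_left, ← hinf, inf_eq_left.2 hyz.le]) fun k => hyz.ne (hf k)
  obtain ⟨h₁, h₂, h₃, h₄, h₅, h₆, h₇⟩ := h
  have : ({f a₁ ⊓ f a₂, f a₁, f b₁, f a₂, f b₂, f a₁ ⊔ f a₂} : Set K) =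
      f '' {a₁ ⊓ a₂, a₁, b₁, a₂, b₂, a₁ ⊔ a₂} := by
    simp [Set.image_insert_eq, hinf, hsup]
  refine ⟨hlt h₁, hlt h₂, by rw [← hinf, h₃, hinf], by rw [← hsup, h₄, hsup], ?_⟩
  rw [this, Set.ncard_image_of_injective _ hf]
  refine ⟨h₅, ?_, ?_⟩
  · rintro _ ⟨y, hy, rfl⟩ _ ⟨z, hz, rfl⟩
    exact ⟨_, h₆ hy hz, hsup _ _⟩
  · rintro _ ⟨y, hy, rfl⟩ _ ⟨z, hz, rfl⟩
    exact ⟨_, h₇ hy hz, hinf _ _⟩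

namespace HExt

variable {L : Type*} [Lattice L] {G : Gadget L}

lemma old_injective : Function.Injective (old : L → HExt G) := fun _ _ => old.inj

lemma old_bot_le (n : HExt G) : old G.bot ≤ n := by
  have := G.bot_le
  cases n <;> simp [le_def, HExt.le, this]

lemma exists_old_of_le {z : L} (hz : z ≠ G.top) {n : HExt G} (hn : n ≤ old z) :
    ∃ t, n = old t := by
  cases n <;> first | exact ⟨_, rfl⟩ | exact (hz hn).elim

lemma old_covBy_old {y z : L} (hz : z ≠ G.top) (h : y ⋖ z) : (old y : HExt G) ⋖ old z := by
  refine ⟨lt_of_le_of_ne h.le fun k => h.lt.ne (old.inj k), fun n hy hn => ?_⟩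
  obtain ⟨t, rfl⟩ := exists_old_of_le hz hn.le
  exact h.2 (lt_of_le_of_ne hy.le (mt (congrArg old) hy.ne))
    (lt_of_le_of_ne hn.le (mt (congrArg old) hn.ne))

/-- A proper element above an old element other than the bottom meets the old elements as some
proper old element does. -/
lemma exists_inf_old {y : L} (hy : y ≠ G.bot) {n : HExt G} (hyn : old y ≤ n)
    (hn : n ≠ old G.top) : ∃ t, y ≤ t ∧ t ≠ G.top ∧ ∀ z, z ≠ G.top → n ⊓ old z = old (t ⊓ z) := by
  rcases n with t | _ | _ | _ | ⟨t, ht⟩ | ⟨t, ht⟩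
  · exact ⟨t, hyn, fun h => hn (h ▸ rfl), fun _ _ => rfl⟩
  · exact (hy hyn).elim
  · exact (hy hyn).elim
  · exact (hy hyn).elim
  · exact ⟨t, hyn, ht.ne_top, fun _ => u_inf_old ht⟩
  · exact ⟨t, hyn, ht.ne_top, fun _ => x_inf_old ht⟩

lemma isSpread_old {x₁ x₂ x₃ : L} (hx : IsSpread G.bot G.top x₁ x₂ x₃) :
    IsSpread (old G.bot : HExt G) (old G.top) (old x₁) (old x₂) (old x₃) := by
  have hsup := fun e (he : e ∈ ({x₁, x₂, x₃} : Set L)) => hx.sup_eq_top he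
  obtain ⟨h₁₂, h₁₃, h₂₃, hx⟩ := hx
  refine ⟨mt old.inj h₁₂, mt old.inj h₁₃, mt old.inj h₂₃, fun e' he' => ?_⟩
  obtain ⟨e, he, rfl⟩ : ∃ e ∈ ({x₁, x₂, x₃} : Set L), e' = old e := by
    simpa using he'
  obtain ⟨hcov, hcov', hcompl⟩ := hx e he
  obtain ⟨hA, hC⟩ := hsup e he
  have hne := hcov.lt.ne'
  have hne' := hcov'.lt.ne
  have key : ∀ n, n ≠ old G.bot → n ≠ old G.top → n ≠ old e →
      old e ⊓ n = (old G.bot : HExt G) ∧ old e ⊔ n = (old G.top : HExt G) := by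
    intro n hb ht hn
    rcases n with z | _ | _ | _ | ⟨z, hz⟩ | ⟨z, hz⟩
    · have := hcompl z (mt (congrArg old) hb) (mt (congrArg old) ht) (mt (congrArg old) hn)
      exact ⟨congrArg old this.1, congrArg old this.2⟩
    · simp [inf_def, HExt.inf, oldInf, sup_def, HExt.sup, oldSup, hne, hne',
        (hA _ Gadget.inA_a).2, (hC _ Gadget.inC_c).2, not_inC_top, mkU_top]
    · simp [inf_def, HExt.inf, oldInf, sup_def, HExt.sup, oldSup, hne, hne',
        (hA _ Gadget.inA_a).2, (hC _ Gadget.inC_d).2, not_inC_top, mkU_top]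
    · simp [inf_def, HExt.inf, oldInf, sup_def, HExt.sup, oldSup, hne, hne',
        (hA _ Gadget.inA_b).2, (hC _ Gadget.inC_d).2, not_inC_top, mkU_top]
    · simp [inf_def, HExt.inf, oldInf, sup_def, HExt.sup, oldSup, hne', (hA _ hz).2, mkU_top,
        inf_comm z, (hcompl z hz.ne_bot hz.ne_top (hA _ hz).1.symm).1]
    · simp [inf_def, HExt.inf, oldInf, sup_def, HExt.sup, oldSup, hne', (hC _ hz).2, mkX_top,
        inf_comm z, (hcompl z hz.ne_bot hz.ne_top (hC _ hz).1.symm).1]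
  refine ⟨old_covBy_old hne' hcov, ⟨lt_of_le_of_ne hcov'.le (mt old.inj hne'), fun n hn hn' => ?_⟩,
    key⟩
  have hb : n ≠ old G.bot := fun h => (h ▸ hn).not_ge (old_bot_le _)
  have := (key n hb hn'.ne hn.ne').2
  rw [sup_eq_right.2 hn.le] at this
  exact hn'.ne this

end HExt

namespace AuxStr.IsHorizontal

open HExt

variable {L H : Type*} [Lattice L] {A : AuxStr L H} {p q : H} (S : A.IsHorizontal p q)
include S

lemma nuExt_greatest {g : H} (h : ∀ k, A.nuExt p q k g) : g = S.one := by
  rcases h S.one with k | ⟨k, -⟩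
  · exact S.eq_one k
  · exact (S.ne_one_left (S.eq_one k)).elim

lemma isStrongN6_old {h k : H} (hhk : ¬ A.nuExt p q h k) (hkh : ¬ A.nuExt p q k h)
    (hs : IsSpanningN6 (old (A.δ h) : HExt S.gadget) (old (A.ε h)) (old (A.δ k)) (old (A.ε k))) :
    IsStrongN6 (old (A.δ h) : HExt S.gadget) (old (A.ε h)) (old (A.δ k)) (old (A.ε k)) := by
  have hh : h ≠ A.zero := fun e => hhk (.inl (e ▸ A.zero_least k))
  have hk : k ≠ A.zero := fun e => hkh (.inl (e ▸ A.zero_least h))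
  have hne : h ≠ k := fun e => hhk (e ▸ nuExt_refl h)
  have h₆ := A.n6 h k hh hk hne
  have hbot : IsBot (A.ε h ⊓ A.ε k) := fun z => old_le_old.1 (hs.2.1 (old z))
  have htop : IsTop (A.δ h ⊔ A.δ k) := fun z => old_le_old.1 (hs.2.2 (old z))
  obtain ⟨-, h₁, h₂, h₃, h₄⟩ := A.strong h k (mt .inl hhk) (mt .inl hkh) ⟨h₆, hbot, htop⟩
  have hb : A.ε h ⊓ A.ε k = S.gadget.bot := le_antisymm (hbot _) (S.gadget.bot_le _)
  have ht : A.δ h ⊔ A.δ k = S.gadget.top := le_antisymm (S.gadget.le_top _) (htop _)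
  have hh₁ : A.δ h ≠ S.gadget.bot := by rw [← hb, ← h₆.2.2.1]; exact h₆.left_ne_inf
  have hk₁ : A.δ k ≠ S.gadget.bot := by
    rw [← hb, ← h₆.2.2.1, inf_comm]; exact h₆.swap.left_ne_inf
  have hh₂ : A.ε h ≠ S.gadget.top := S.eps_ne_top hh
  have hk₂ : A.ε k ≠ S.gadget.top := S.eps_ne_top hk
  rw [hb] at h₁ h₂ h₃ h₄
  rw [ht] at h₁ h₂ h₃ h₄
  have hlt : ∀ {y z : L}, (old y : HExt S.gadget) < old z → y < z := fun h =>
    lt_of_le_of_ne h.le (mt (congrArg old) h.ne)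
  refine ⟨hs, ?_⟩
  simp only [old_inf_old, old_sup_old, hb, ht]
  refine ⟨fun n hn hn' => ?_, fun n hn hn' => ?_, fun n hn hn' => ?_, fun n hn hn' => ?_⟩
  · obtain ⟨t, rfl⟩ := exists_old_of_le hh₂ hn'
    exact congrArg old (h₁ t (hlt hn) hn')
  · obtain ⟨t, rfl⟩ := exists_old_of_le hk₂ hn'
    exact congrArg old (h₂ t (hlt hn) hn')
  · obtain ⟨t, hyt, htt, hinf⟩ := exists_inf_old hh₁ hn hn'.ne
    rw [hinf _ hk₂, h₃ t hyt (lt_of_le_of_ne (S.gadget.le_top t) htt)]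
  · obtain ⟨t, hyt, htt, hinf⟩ := exists_inf_old hk₁ hn hn'.ne
    rw [hinf _ hh₂, h₄ t hyt (lt_of_le_of_ne (S.gadget.le_top t) htt)]

/-- The horizontal extension of an auxiliary structure. -/
def extension : AuxStr (HExt S.gadget) H where
  γ := S.col
  ν := A.nuExt p q
  δ h := old (A.δ h)
  ε h := old (A.ε h)
  zero := A.zero
  quasi := S.isQuasiColored_col
  zero_least h := .inl (A.zero_least h)
  least_unique z hz := by
    rcases hz A.zero with k | ⟨-, k⟩
    · exact A.least_unique z fun h => nu_trans k (A.zero_least h)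
    · exact (S.not_nu' (nu_trans k (A.zero_least p))).elim
  greatest_unique g₁ g₂ h₁ h₂ := (S.nuExt_greatest h₁).trans (S.nuExt_greatest h₂).symm
  delta_zero := congrArg old A.delta_zero
  delta_covby h hh := old_covBy_old (S.eps_ne_top hh) (A.delta_covby h hh)
  gamma_delta := A.gamma_delta
  n6 h k hh hk hhk :=
    (A.n6 h k hh hk hhk).map old_injective (fun _ _ => rfl) (fun _ _ => rfl)
  strong _ _ := S.isStrongN6_old
  atoms3 bot top hbot htop _ := by
    obtain rfl : bot = old S.gadget.bot := le_antisymm (hbot _) (old_bot_le _)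
    obtain rfl : top = old S.gadget.top := le_antisymm (le_old_top _) (htop _)
    obtain ⟨x₁, x₂, x₃, hx⟩ := S.exists_isSpread
    exact ⟨_, _, _, isSpread_old hx⟩
  notfull g hg _ := by
    obtain rfl := S.nuExt_greatest hg
    refine ⟨old S.gadget.bot, old S.gadget.top, fun h => S.not_psi ?_⟩
    refine h _ (isLatCon_extRel S.isLatCon_psi (fun _ _ => id) fun _ => S.gadget.rel_ab) ?_
    rintro _ ⟨h, hh, rfl⟩
    exact S.psi_delta hh

end AuxStr.IsHorizontal

lemma HExt.countable {L : Type*} [Lattice L] (G : Gadget L) [Countable L] :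
    Countable (HExt G) := by
  let f : HExt G → Fin 6 × Option L := fun
    | old z => (0, some z)
    | o => (1, none)
    | s => (2, none)
    | w => (3, none)
    | u y _ => (4, some y)
    | x y _ => (5, some y)
  refine Function.Injective.countable (f := f) fun n n' => ?_
  cases n <;> cases n' <;> simp [f]

/-- Horizontal extension (Lemma 3.4): if `p ∥_ν q` and `(δ p, ε p, δ q, ε q)` is a
spanning N₆-quadruple, then the auxiliary structure extends to one with the same color
set `H`, the same `δ`, `ε`, and with quasiorder generated by `ν ∪ {(p, q)}`;
countability is preserved. -/
theorem stmt16 {L : Type u} {H : Type v} [Lattice L] (A : AuxStr L H)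
    (p q : H) (hpq : ¬ A.ν p q) (hqp : ¬ A.ν q p)
    (hspan : IsSpanningN6 (A.δ p) (A.ε p) (A.δ q) (A.ε q)) :
    ∃ (L' : Type u) (_ : Lattice L') (B : AuxStr L' H) (sub : AuxSub A B),
      sub.g = id ∧
      B.ν = quoClosure (fun x y : H => A.ν x y ∨ (x = p ∧ y = q)) ∧
      (Countable L ∧ Countable H → Countable L' ∧ Countable H) := by
  have S : A.IsHorizontal p q := ⟨hpq, hqp, hspan⟩
  refine ⟨HExt S.gadget, inferInstance, S.extension,
    { f := HExt.old
      g := id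
      f_inj := HExt.old_injective
      g_inj := Function.injective_id
      f_inf := fun _ _ => rfl
      f_sup := fun _ _ => rfl
      g_zero := rfl
      nu_mono := fun _ _ => .inl
      gamma_comm := fun _ _ _ => rfl
      delta_comm := fun _ => rfl
      eps_comm := fun _ => rfl }, rfl, AuxStr.nuExt_eq_quoClosure, fun ⟨_, hH⟩ => ?_⟩
  exact ⟨HExt.countable _, hH⟩
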